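/- Let a > 0, a ≠ 1, b > 0, and let ψ be a smooth function on ℝ^d vanishing near the origin and equal to 1 near infinity. Define m_{a,b}(ξ) = ψ(ξ) |ξ|^{-b} e^{i|ξ|^a}. Let Ψ be a Schwartz function on ℝ^d whose Fourier transform is supported in {1/2 ≤ |ξ| ≤ 2} with Σ_j Ψ̂(2^{-j}ξ) = 1 for ξ ≠ 0. Then for s = b/a and any r with rs > d, sup_{j∈ℤ} ‖m_{a,b}(2^j ·) Ψ̂‖_{L^r_s(ℝ^d)} < ∞. -/

import Mathlib

open MeasureTheory Real FourierTransform
open scoped ENNReal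

/-- The Sobolev norm `‖g‖_{L^r_s} = ‖(I-Δ)^{s/2} g‖_{L^r}`. -/
noncomputable def sobolevNorm {ι : Type*} [Fintype ι] (s r : ℝ)
    (g : EuclideanSpace ℝ ι → ℂ) : ℝ≥0∞ :=
  eLpNorm (𝓕⁻ (fun ξ => (((1 + 4 * π ^ 2 * ‖ξ‖ ^ 2) ^ (s / 2) : ℝ) : ℂ) * 𝓕 g ξ))
    (ENNReal.ofReal r) volume

section FractionalBounds

open SchwartzMap Laplacian Set Filter Topology

section HeatAverages

variable {E : Type*} [NormedAddCommGroup E] [InnerProductSpace ℝ E] [FiniteDimensional ℝ E]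
  [MeasurableSpace E] [BorelSpace E]

/-- Interpolation between `L¹` and `L^∞`. -/
lemma eLpNorm_le_of_enorm_le_of_lintegral_le {f : E → ℂ} {B : ℝ≥0∞} (hB : B ≠ ∞)
    {r : ℝ} (hr : 1 ≤ r) (h_sup : ∀ x, ‖f x‖ₑ ≤ B) (h_int : ∫⁻ x, ‖f x‖ₑ ≤ B) :
    eLpNorm f (ENNReal.ofReal r) volume ≤ B := by
  have hr0 : 0 < r := by linarith
  rw [eLpNorm_eq_lintegral_rpow_enorm_toReal (by simpa using hr0) ENNReal.ofReal_ne_top,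
    ENNReal.toReal_ofReal hr0.le]
  have key : ∫⁻ x, ‖f x‖ₑ ^ r ≤ B ^ r := by
    calc ∫⁻ x, ‖f x‖ₑ ^ r ≤ ∫⁻ x, B ^ (r - 1) * ‖f x‖ₑ := by
          refine lintegral_mono fun x => ?_
          have : ‖f x‖ₑ ^ r = ‖f x‖ₑ ^ (r - 1) * ‖f x‖ₑ := by
            conv_rhs => rw [← ENNReal.rpow_one ‖f x‖ₑ, ← ENNReal.rpow_mul,
              ← ENNReal.rpow_add_of_nonneg _ _ (by linarith) zero_le_one]
            congr 1; ring
          rw [this]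
          gcongr
          exact h_sup x
      _ = B ^ (r - 1) * ∫⁻ x, ‖f x‖ₑ := by
          rw [lintegral_const_mul' _ _ (ENNReal.rpow_ne_top_of_nonneg (by linarith) hB)]
      _ ≤ B ^ (r - 1) * B := by gcongr
      _ = B ^ r := by
          conv_lhs => rw [← ENNReal.rpow_one B, ← ENNReal.rpow_mul,
              ← ENNReal.rpow_add_of_nonneg _ _ (by linarith) zero_le_one]
          congr 1; ring
  calc (∫⁻ x, ‖f x‖ₑ ^ r) ^ (1 / r) ≤ (B ^ r) ^ (1 / r) := by gcongr
    _ = B := by rw [← ENNReal.rpow_mul, mul_one_div_cancel hr0.ne', ENNReal.rpow_one]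

/-- The inverse Fourier transform turns multiplication by a characteristic function into averaging
over translates. -/
lemma fourierInv_charFun_mul_fourier (ρ : Measure E) [IsFiniteMeasure ρ] (h : 𝓢(E, ℂ)) (x : E) :
    𝓕⁻ (fun ξ => charFun ρ ((2 * π) • ξ) * 𝓕 (h : E → ℂ) ξ) x = ∫ y, h (x + y) ∂ρ := by
  have hint : Integrable (𝓕 (h : E → ℂ)) := by
    rw [← SchwartzMap.fourier_coe]; exact (𝓕 h).integrable
  have hinv : ∀ z, h z = 𝓕⁻ (𝓕 (h : E → ℂ)) z := fun z => by
    rw [h.continuous.fourierInv_fourier_eq h.integrable hint]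
  simp_rw [hinv, Real.fourierInv_eq', charFun_apply, smul_eq_mul]
  rw [integral_integral_swap]
  · refine integral_congr_ae (.of_forall fun ξ => ?_)
    simp only
    rw [← mul_assoc, ← integral_const_mul, ← integral_mul_const]
    refine integral_congr_ae (.of_forall fun y => ?_)
    beta_reduce
    rw [← Complex.exp_add, inner_add_right, real_inner_smul_right, real_inner_comm y ξ]
    push_cast
    ring_nf
  · have h1 : Integrable (fun p : E × E => 𝓕 (h : E → ℂ) p.2) (ρ.prod volume) := by
      exact hint.comp_snd ρ
    refine h1.bdd_mul (c := 1) ?_ (.of_forall fun p => ?_)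
    · refine Continuous.aestronglyMeasurable ?_
      fun_prop
    · rw [Complex.norm_exp_ofReal_mul_I]

/-- Averaging over translates is bounded on `L^r`. -/
lemma eLpNorm_fourierInv_charFun_mul_fourier_le (ρ : Measure E) [IsFiniteMeasure ρ] (h : 𝓢(E, ℂ))
    {B : ℝ≥0∞} (hB : B ≠ ∞) {r : ℝ} (hr : 1 ≤ r) (h_sup : ∀ x, ‖h x‖ₑ ≤ B)
    (h_int : ∫⁻ x, ‖h x‖ₑ ≤ B) :
    eLpNorm (𝓕⁻ (fun ξ => charFun ρ ((2 * π) • ξ) * 𝓕 (h : E → ℂ) ξ))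
      (ENNReal.ofReal r) volume ≤ ρ univ * B := by
  refine eLpNorm_le_of_enorm_le_of_lintegral_le (ENNReal.mul_ne_top (measure_ne_top _ _) hB) hr
    (fun x => ?_) ?_
  · rw [fourierInv_charFun_mul_fourier]
    refine (enorm_integral_le_lintegral_enorm _).trans ?_
    refine (lintegral_mono (g := fun _ => B) fun y => h_sup _).trans ?_
    rw [lintegral_const, mul_comm]
  · simp_rw [fourierInv_charFun_mul_fourier]
    calc ∫⁻ x, ‖∫ y, h (x + y) ∂ρ‖ₑ ≤ ∫⁻ x, ∫⁻ y, ‖h (x + y)‖ₑ ∂ρ :=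
          lintegral_mono fun x => enorm_integral_le_lintegral_enorm _
      _ = ∫⁻ y, (∫⁻ x, ‖h (x + y)‖ₑ) ∂ρ := by
          refine lintegral_lintegral_swap ?_
          refine Continuous.aemeasurable ?_
          have := h.continuous
          simp only [Function.uncurry_def]
          fun_prop
      _ ≤ ∫⁻ y, B ∂ρ := by
          refine lintegral_mono fun y => ?_
          exact (lintegral_add_right_eq_self (fun x => ‖h x‖ₑ) y).le.trans h_int
      _ = ρ univ * B := by rw [lintegral_const, mul_comm]

lemma integrable_charFun_mul_fourier (ρ : Measure E) [IsFiniteMeasure ρ] (h : 𝓢(E, ℂ)) :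
    Integrable (fun ξ => charFun ρ ((2 * π) • ξ) * 𝓕 (h : E → ℂ) ξ) := by
  have hint : Integrable (𝓕 (h : E → ℂ)) := by
    rw [← SchwartzMap.fourier_coe]; exact (𝓕 h).integrable
  refine hint.bdd_mul (c := ρ.real univ) ?_ (.of_forall fun ξ => norm_charFun_le _)
  exact (stronglyMeasurable_charFun.comp_measurable
    (measurable_const_smul (2 * π))).aestronglyMeasurable

lemma continuous_fourierInv_of_integrable {f : E → ℂ} (hf : Integrable f) :
    Continuous (𝓕⁻ f) := by
  have : 𝓕⁻ f = fun x => 𝓕 f (-x) := by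
    ext x; rw [Real.fourierInv_eq_fourier_neg]
  rw [this]
  have h2 : Continuous (𝓕 f) :=
    VectorFourier.fourierIntegral_continuous Real.continuous_fourierChar
      continuous_inner hf
  fun_prop

/-- Averages of the heat semigroup `e^{-t(1-Δ)}` have characteristic functions as symbols. -/
lemma exists_charFun_eq_integral_exp (ν : Measure ℝ) [IsFiniteMeasure ν]
    (hν : ∀ᵐ t ∂ν, 0 ≤ t) :
    ∃ ρ : Measure E, IsFiniteMeasure ρ ∧ ρ univ ≤ ν univ ∧
      ∀ ξ : E, charFun ρ ((2 * π) • ξ)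
        = ((∫ t, Real.exp (-(t * (1 + 4 * π ^ 2 * ‖ξ‖ ^ 2))) ∂ν : ℝ) : ℂ) := by
  set D : ℝ → ℝ≥0∞ := fun t => ENNReal.ofReal (Real.exp (-t)) with hD
  have hDm : Measurable D := by fun_prop
  set ν' := ν.withDensity D with hν'
  have hmass : ν' univ ≤ ν univ := by
    rw [hν', withDensity_apply _ MeasurableSet.univ, Measure.restrict_univ]
    calc ∫⁻ t, D t ∂ν ≤ ∫⁻ t, 1 ∂ν := by
          refine lintegral_mono_ae ?_
          filter_upwards [hν] with t ht
          simp only [hD]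
          rw [ENNReal.ofReal_le_one]
          simpa using ht
      _ = ν univ := by simp
  have hfin : IsFiniteMeasure ν' := ⟨hmass.trans_lt (measure_lt_top ν _)⟩
  set Y : ℝ × E → E := fun p => √(2 * p.1) • p.2 with hY
  have hYm : Measurable Y := by fun_prop
  set γ := ProbabilityTheory.stdGaussian E
  refine ⟨(ν'.prod γ).map Y, inferInstance, ?_, fun ξ => ?_⟩
  · rw [Measure.map_apply hYm MeasurableSet.univ, preimage_univ, ← univ_prod_univ,
      Measure.prod_prod, measure_univ (μ := γ), mul_one]
    exact hmass
  · rw [charFun_apply, integral_map hYm.aemeasurable (by fun_prop), integral_prod,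
      ← integral_complex_ofReal]
    · rw [hν', integral_withDensity_eq_integral_toReal_smul hDm (by simp [hD])]
      refine integral_congr_ae ?_
      filter_upwards [hν] with t ht
      have : ∀ y : E, Complex.exp (((inner ℝ (Y (t, y)) ((2 * π) • ξ) : ℝ) : ℂ) * Complex.I)
          = Complex.exp (((inner ℝ y ((√(2 * t) * (2 * π)) • ξ) : ℝ) : ℂ) * Complex.I) := by
        intro y
        simp only [hY, real_inner_smul_left, real_inner_smul_right]
        push_cast; ring_nf
      simp_rw [this]
      rw [← charFun_apply, ProbabilityTheory.charFun_stdGaussian]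
      rw [ENNReal.toReal_ofReal (Real.exp_pos _).le, norm_smul, Real.norm_of_nonneg (by positivity)]
      rw [Complex.real_smul]
      norm_cast
      rw [← Real.exp_add]
      congr 1
      rw [mul_pow, mul_pow, Real.sq_sqrt (by positivity)]
      ring
    · refine Integrable.of_bound (C := 1) ?_ (.of_forall fun p => ?_)
      · exact Measurable.aestronglyMeasurable (by fun_prop)
      · rw [Complex.norm_exp_ofReal_mul_I]

end HeatAverages

/-- Splitting of the subordination formula for `w ^ θ` at the scale `μ`. -/
lemma exists_measure_rpow_eq {θ μ : ℝ} (hθ0 : 0 ≤ θ) (hθ1 : θ < 1) (hμ : 0 < μ) :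
    ∃ ν₁ ν₂ ν₃ : Measure ℝ,
      (ν₁ univ ≤ ENNReal.ofReal (μ ^ (θ - 1) / (1 - θ)) ∧ ∀ᵐ t ∂ν₁, 0 ≤ t) ∧
      (ν₂ univ ≤ ENNReal.ofReal (μ ^ θ) ∧ ∀ᵐ t ∂ν₂, 0 ≤ t) ∧
      (ν₃ univ ≤ ENNReal.ofReal (μ ^ θ) ∧ ∀ᵐ t ∂ν₃, 0 ≤ t) ∧
      ∀ w : ℝ, 0 < w → Real.Gamma (1 - θ) * w ^ θ
        = w * (∫ t, Real.exp (-(t * w)) ∂ν₁) + (∫ t, Real.exp (-(t * w)) ∂ν₂)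
          - ∫ t, Real.exp (-(t * w)) ∂ν₃ := by
  have hμi : 0 < μ⁻¹ := inv_pos.2 hμ
  have hm1 : Measurable fun t : ℝ => ENNReal.ofReal (t ^ (-θ)) := by fun_prop
  have hm3 : Measurable fun t : ℝ => ENNReal.ofReal (θ * t ^ (-θ - 1)) := by fun_prop
  have hi1 : IntegrableOn (fun t : ℝ => t ^ (-θ)) (Ioc 0 μ⁻¹) := by
    rw [← intervalIntegrable_iff_integrableOn_Ioc_of_le hμi.le]
    exact intervalIntegral.intervalIntegrable_rpow' (by linarith)
  have hi3 : IntegrableOn (fun t : ℝ => θ * t ^ (-θ - 1)) (Ioi μ⁻¹) := by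
    rcases hθ0.eq_or_lt with rfl | h
    · simp
    · exact (integrableOn_Ioi_rpow_of_lt (by linarith) hμi).const_mul _
  refine ⟨(volume.restrict (Ioc 0 μ⁻¹)).withDensity fun t => ENNReal.ofReal (t ^ (-θ)),
    ENNReal.ofReal (μ ^ θ) • Measure.dirac μ⁻¹,
    (volume.restrict (Ioi μ⁻¹)).withDensity fun t => ENNReal.ofReal (θ * t ^ (-θ - 1)),
    ⟨?_, ?_⟩, ⟨?_, ?_⟩, ⟨?_, ?_⟩, fun w hw => ?_⟩
  · rw [withDensity_apply _ MeasurableSet.univ, Measure.restrict_univ,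
      ← ofReal_integral_eq_lintegral_ofReal hi1
        ((ae_restrict_mem measurableSet_Ioc).mono fun t ht => Real.rpow_nonneg ht.1.le _),
      ← intervalIntegral.integral_of_le hμi.le, integral_rpow (.inl (by linarith)),
      Real.zero_rpow (by linarith), sub_zero, Real.inv_rpow hμ.le, ← Real.rpow_neg hμ.le]
    apply le_of_eq; congr 2 <;> [congr 1; skip] <;> ring
  · refine (withDensity_absolutelyContinuous _ _).ae_le ?_
    exact (ae_restrict_mem measurableSet_Ioc).mono fun t ht => ht.1.le
  · simp
  · refine Measure.ae_smul_measure ?_ _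
    rw [ae_dirac_iff measurableSet_Ici]
    exact hμi.le
  · rw [withDensity_apply _ MeasurableSet.univ, Measure.restrict_univ,
      ← ofReal_integral_eq_lintegral_ofReal hi3
        ((ae_restrict_mem measurableSet_Ioi).mono fun t (ht : μ⁻¹ < t) =>
          mul_nonneg hθ0 (Real.rpow_nonneg (hμi.trans ht).le _))]
    refine ENNReal.ofReal_le_ofReal ?_
    rcases hθ0.eq_or_lt with rfl | h
    · simp
    · rw [integral_const_mul, integral_Ioi_rpow_of_lt (by linarith) hμi, sub_add_cancel,
        Real.inv_rpow hμ.le, ← Real.rpow_neg hμ.le, neg_neg, neg_div_neg_eq,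
        mul_div_cancel₀ _ h.ne']
  · refine (withDensity_absolutelyContinuous _ _).ae_le ?_
    exact (ae_restrict_mem measurableSet_Ioi).mono fun t (ht : μ⁻¹ < t) => (hμi.trans ht).le
  · rw [integral_withDensity_eq_integral_toReal_smul hm1 (by simp),
      integral_withDensity_eq_integral_toReal_smul hm3 (by simp), integral_smul_measure,
      integral_dirac, ENNReal.toReal_ofReal (by positivity)]
    simp only [smul_eq_mul]
    have e1 : ∫ t in Ioc 0 μ⁻¹, (ENNReal.ofReal (t ^ (-θ))).toReal * Real.exp (-(t * w))
        = ∫ t in Ioc 0 μ⁻¹, t ^ (-θ) * Real.exp (-(w * t)) := by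
      refine setIntegral_congr_fun measurableSet_Ioc fun t ht => ?_
      rw [ENNReal.toReal_ofReal (Real.rpow_nonneg ht.1.le _), mul_comm t w]
    have e3 : ∫ t in Ioi μ⁻¹, (ENNReal.ofReal (θ * t ^ (-θ - 1))).toReal * Real.exp (-(t * w))
        = ∫ t in Ioi μ⁻¹, θ * t ^ (-θ - 1) * Real.exp (-(w * t)) := by
      refine setIntegral_congr_fun measurableSet_Ioi fun t (ht : μ⁻¹ < t) => ?_
      rw [ENNReal.toReal_ofReal (mul_nonneg hθ0 (Real.rpow_nonneg (hμi.trans ht).le _)),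
        mul_comm t w]
    rw [e1, e3]
    have hG := Real.integral_rpow_mul_exp_neg_mul_Ioi (a := 1 - θ) (r := w) (by linarith) hw
    rw [show 1 - θ - 1 = -θ by ring] at hG
    have hGi : IntegrableOn (fun t : ℝ => t ^ (-θ) * Real.exp (-(w * t))) (Ioi 0) := by
      refine .of_integral_ne_zero ?_
      rw [hG]
      have := Real.Gamma_pos_of_pos (s := 1 - θ) (by linarith)
      positivity
    have hsub : Ioi μ⁻¹ ⊆ Ioi (0 : ℝ) := Ioi_subset_Ioi hμi.le
    have hsplit : ∫ t in Ioi 0, t ^ (-θ) * Real.exp (-(w * t))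
        = (∫ t in Ioc 0 μ⁻¹, t ^ (-θ) * Real.exp (-(w * t)))
          + ∫ t in Ioi μ⁻¹, t ^ (-θ) * Real.exp (-(w * t)) := by
      rw [← Ioc_union_Ioi_eq_Ioi hμi.le, setIntegral_union (Ioc_disjoint_Ioi le_rfl)
        measurableSet_Ioi (hGi.mono_set Ioc_subset_Ioi_self) (hGi.mono_set hsub)]
    have hGi' := hGi.mono_set hsub
    have h3i : IntegrableOn (fun t : ℝ => θ * t ^ (-θ - 1) * Real.exp (-(w * t))) (Ioi μ⁻¹) := by
      refine Integrable.mul_bdd (c := 1) hi3 (by fun_prop) ?_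
      refine (ae_restrict_mem measurableSet_Ioi).mono fun t (ht : μ⁻¹ < t) => ?_
      have : 0 < w * t := mul_pos hw (hμi.trans ht)
      rw [Real.norm_of_nonneg (Real.exp_pos _).le, Real.exp_le_one_iff]
      linarith
    have h3n : IntegrableOn (fun t : ℝ => -(θ * t ^ (-θ - 1) * Real.exp (-(w * t)))) (Ioi μ⁻¹) :=
      h3i.neg
    have hparts := integral_Ioi_of_hasDerivAt_of_tendsto' (a := μ⁻¹) (m := 0)
      (f := fun t : ℝ => t ^ (-θ) * Real.exp (-(w * t)))
      (f' := fun t : ℝ => -(θ * t ^ (-θ - 1) * Real.exp (-(w * t)))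
        - w * (t ^ (-θ) * Real.exp (-(w * t)))) ?_ (h3n.sub (hGi'.const_mul w)) ?_
    · rw [integral_sub h3n (hGi'.const_mul w), integral_neg, integral_const_mul] at hparts
      have hinv : μ⁻¹ ^ (-θ) = μ ^ θ := by
        rw [Real.inv_rpow hμ.le, ← Real.rpow_neg hμ.le, neg_neg]
      rw [hinv] at hparts
      have hw' : w * (1 / w) ^ (1 - θ) = w ^ θ := by
        rw [one_div, Real.inv_rpow hw.le, ← Real.rpow_neg hw.le]
        nth_rewrite 1 [← Real.rpow_one w]
        rw [← Real.rpow_add hw]; congr 1; ring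
      rw [← hw', mul_comm μ⁻¹ w]
      have : Real.Gamma (1 - θ) * (w * (1 / w) ^ (1 - θ))
          = w * ((1 / w) ^ (1 - θ) * Real.Gamma (1 - θ)) := by ring
      rw [this, ← hG, hsplit]
      linarith
    · intro t (ht : μ⁻¹ ≤ t)
      have ht0 : 0 < t := hμi.trans_le ht
      have h1 := Real.hasDerivAt_rpow_const (x := t) (p := -θ) (.inl ht0.ne')
      have h2 : HasDerivAt (fun t : ℝ => Real.exp (-(w * t)))
          (Real.exp (-(w * t)) * (-(w * 1))) t :=
        ((hasDerivAt_id t).const_mul w).neg.exp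
      exact (h1.mul h2).congr_deriv (by ring)
    · exact tendsto_rpow_mul_exp_neg_mul_atTop_nhds_zero (-θ) w hw |>.congr fun t => by
        rw [neg_mul]

section BesselPotential

variable {E : Type*} [NormedAddCommGroup E] [InnerProductSpace ℝ E] [FiniteDimensional ℝ E]
  [MeasurableSpace E] [BorelSpace E]

lemma fourier_sub_laplacian (g : 𝓢(E, ℂ)) (ξ : E) :
    𝓕 (g - Δ g) ξ = ((1 + 4 * π ^ 2 * ‖ξ‖ ^ 2 : ℝ) : ℂ) * 𝓕 g ξ := by
  have h : (fun x : E => ‖x‖ ^ 2).HasTemperateGrowth := by fun_prop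
  have h2 : 𝓕 (Δ g) ξ = -(2 * π) ^ 2 * ‖ξ‖ ^ 2 * 𝓕 g ξ := by
    rw [laplacian_eq_fourierMultiplierCLM, fourierMultiplierCLM_apply,
      FourierTransform.fourier_smul, FourierTransform.fourier_fourierInv_eq, smul_apply,
      SchwartzMap.smulLeftCLM_apply_apply h, Complex.real_smul, Complex.real_smul]
    push_cast
    ring
  have h3 : 𝓕 (g - Δ g) = 𝓕 g - 𝓕 (Δ g) := by
    rw [sub_eq_add_neg, FourierTransform.fourier_add, FourierTransform.fourier_neg, sub_eq_add_neg]
  rw [h3, sub_apply, h2]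
  push_cast
  ring

lemma fourier_iterate_sub_laplacian (g : 𝓢(E, ℂ)) (k : ℕ) (ξ : E) :
    𝓕 ((fun f : 𝓢(E, ℂ) => f - Δ f)^[k] g) ξ
      = ((1 + 4 * π ^ 2 * ‖ξ‖ ^ 2 : ℝ) : ℂ) ^ k * 𝓕 g ξ := by
  induction k with
  | zero => simp
  | succ k ih => rw [Function.iterate_succ_apply', fourier_sub_laplacian, ih]; ring

/-- Interpolation of `(1-Δ)^{s/2}` between two consecutive integer powers of `1-Δ`. -/
lemma exists_eLpNorm_bessel_le {s r : ℝ} (hs : 0 ≤ s) (hr : 1 ≤ r) :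
    ∃ C : ℝ, ∀ (g : 𝓢(E, ℂ)) (B μ : ℝ), 0 ≤ B → 0 < μ →
      (∀ i ≤ ⌊s / 2⌋₊ + 1,
        (∀ x, ‖((fun f : 𝓢(E, ℂ) => f - Δ f)^[i] g) x‖ₑ ≤ ENNReal.ofReal (B * μ ^ i)) ∧
        ∫⁻ x, ‖((fun f : 𝓢(E, ℂ) => f - Δ f)^[i] g) x‖ₑ ≤ ENNReal.ofReal (B * μ ^ i)) →
      eLpNorm (𝓕⁻ (fun ξ => (((1 + 4 * π ^ 2 * ‖ξ‖ ^ 2) ^ (s / 2) : ℝ) : ℂ) * 𝓕 (g : E → ℂ) ξ))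
        (ENNReal.ofReal r) volume ≤ ENNReal.ofReal (C * (B * μ ^ (s / 2))) := by
  set k := ⌊s / 2⌋₊ with hk
  set θ := s / 2 - k with hθ
  have hθ0 : 0 ≤ θ := sub_nonneg.2 (Nat.floor_le (by positivity))
  have hθ1 : θ < 1 := by have := Nat.lt_floor_add_one (s / 2); rw [hθ]; linarith
  have hΓ : 0 < Real.Gamma (1 - θ) := Real.Gamma_pos_of_pos (by linarith)
  have h1θ : 0 < 1 - θ := by linarith
  refine ⟨(Real.Gamma (1 - θ))⁻¹ * (1 / (1 - θ) + 1 + 1), fun g B μ hB hμ hbd => ?_⟩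
  obtain ⟨ν₁, ν₂, ν₃, ⟨hm1, hp1⟩, ⟨hm2, hp2⟩, ⟨hm3, hp3⟩, hid⟩ :=
    exists_measure_rpow_eq hθ0 hθ1 hμ
  have : IsFiniteMeasure ν₁ := ⟨hm1.trans_lt ENNReal.ofReal_lt_top⟩
  have : IsFiniteMeasure ν₂ := ⟨hm2.trans_lt ENNReal.ofReal_lt_top⟩
  have : IsFiniteMeasure ν₃ := ⟨hm3.trans_lt ENNReal.ofReal_lt_top⟩
  obtain ⟨ρ₁, hf1, hr1, hc1⟩ := exists_charFun_eq_integral_exp (E := E) ν₁ hp1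
  obtain ⟨ρ₂, hf2, hr2, hc2⟩ := exists_charFun_eq_integral_exp (E := E) ν₂ hp2
  obtain ⟨ρ₃, hf3, hr3, hc3⟩ := exists_charFun_eq_integral_exp (E := E) ν₃ hp3
  set h := (fun f : 𝓢(E, ℂ) => f - Δ f)^[k] g with hh
  set h' := (fun f : 𝓢(E, ℂ) => f - Δ f)^[k + 1] g with hh'
  set f₁ : E → ℂ := fun ξ => charFun ρ₁ ((2 * π) • ξ) * 𝓕 (h' : E → ℂ) ξ with hf₁
  set f₂ : E → ℂ := fun ξ => charFun ρ₂ ((2 * π) • ξ) * 𝓕 (h : E → ℂ) ξ with hf₂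
  set f₃ : E → ℂ := fun ξ => charFun ρ₃ ((2 * π) • ξ) * 𝓕 (h : E → ℂ) ξ with hf₃
  have hi1 : Integrable f₁ := integrable_charFun_mul_fourier ρ₁ h'
  have hi2 : Integrable f₂ := integrable_charFun_mul_fourier ρ₂ h
  have hi3 : Integrable f₃ := integrable_charFun_mul_fourier ρ₃ h
  have hsymb : (fun ξ => (((1 + 4 * π ^ 2 * ‖ξ‖ ^ 2) ^ (s / 2) : ℝ) : ℂ) * 𝓕 (g : E → ℂ) ξ)
      = fun ξ => ((Real.Gamma (1 - θ))⁻¹ : ℂ) * (f₁ ξ + f₂ ξ - f₃ ξ) := by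
    ext ξ
    have hw : 0 < 1 + 4 * π ^ 2 * ‖ξ‖ ^ 2 := by positivity
    have e1 : 𝓕 (h : E → ℂ) ξ = ((1 + 4 * π ^ 2 * ‖ξ‖ ^ 2 : ℝ) : ℂ) ^ k * 𝓕 (g : E → ℂ) ξ :=
      fourier_iterate_sub_laplacian g k ξ
    have e2 : 𝓕 (h' : E → ℂ) ξ
        = ((1 + 4 * π ^ 2 * ‖ξ‖ ^ 2 : ℝ) : ℂ) ^ (k + 1) * 𝓕 (g : E → ℂ) ξ :=
      fourier_iterate_sub_laplacian g (k + 1) ξ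
    have e3 := congrArg (fun z : ℝ => (z : ℂ)) (hid _ hw)
    have e4 : (1 + 4 * π ^ 2 * ‖ξ‖ ^ 2) ^ (s / 2)
        = (1 + 4 * π ^ 2 * ‖ξ‖ ^ 2) ^ θ * (1 + 4 * π ^ 2 * ‖ξ‖ ^ 2) ^ k := by
      rw [← Real.rpow_natCast _ k, ← Real.rpow_add hw, hθ, sub_add_cancel]
    have hΓ' : (Real.Gamma (1 - θ) : ℂ) ≠ 0 := by exact_mod_cast hΓ.ne'
    simp only [hf₁, hf₂, hf₃]
    rw [hc1, hc2, hc3, e1, e2, e4, eq_inv_mul_iff_mul_eq₀ hΓ']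
    rw [Complex.ofReal_mul, Complex.ofReal_sub, Complex.ofReal_add, Complex.ofReal_mul] at e3
    rw [Complex.ofReal_mul, Complex.ofReal_pow]
    linear_combination (((1 + 4 * π ^ 2 * ‖ξ‖ ^ 2 : ℝ) : ℂ) ^ k * 𝓕 (g : E → ℂ) ξ) * e3
  have hlin : 𝓕⁻ (fun ξ => ((Real.Gamma (1 - θ))⁻¹ : ℂ) * (f₁ ξ + f₂ ξ - f₃ ξ))
      = ((Real.Gamma (1 - θ))⁻¹ : ℂ) • (𝓕⁻ f₁ + 𝓕⁻ f₂ - 𝓕⁻ f₃) := by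
    have hint : ∀ {f : E → ℂ}, Integrable f → ∀ x : E,
        Integrable (fun v => 𝐞 (inner ℝ v x) • f v) := fun hf x => by
      have := (Real.fourierIntegral_convergent_iff (f := _) (-x)).2 hf
      simpa using this
    ext x
    simp only [Pi.smul_apply, Pi.add_apply, Pi.sub_apply, smul_eq_mul]
    simp only [Real.fourierInv_eq]
    have hadd : Integrable (fun v => 𝐞 (inner ℝ v x) • f₁ v + 𝐞 (inner ℝ v x) • f₂ v) :=
      (hint hi1 x).add (hint hi2 x)
    rw [← integral_add (hint hi1 x) (hint hi2 x), ← integral_sub hadd (hint hi3 x),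
      ← integral_const_mul]
    refine integral_congr_ae (.of_forall fun v => ?_)
    simp only [Circle.smul_def, smul_eq_mul]
    ring
  have hr' : 1 ≤ ENNReal.ofReal r := by simpa using hr
  have hb1 := eLpNorm_fourierInv_charFun_mul_fourier_le ρ₁ h' ENNReal.ofReal_ne_top hr
    (hbd (k + 1) le_rfl).1 (hbd (k + 1) le_rfl).2
  have hb2 := eLpNorm_fourierInv_charFun_mul_fourier_le ρ₂ h ENNReal.ofReal_ne_top hr
    (hbd k k.le_succ).1 (hbd k k.le_succ).2
  have hb3 := eLpNorm_fourierInv_charFun_mul_fourier_le ρ₃ h ENNReal.ofReal_ne_top hr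
    (hbd k k.le_succ).1 (hbd k k.le_succ).2
  have c1 := (continuous_fourierInv_of_integrable hi1).aestronglyMeasurable (μ := volume)
  have c2 := (continuous_fourierInv_of_integrable hi2).aestronglyMeasurable (μ := volume)
  have c3 := (continuous_fourierInv_of_integrable hi3).aestronglyMeasurable (μ := volume)
  rw [hsymb, hlin, eLpNorm_const_smul]
  calc _ ≤ ‖((Real.Gamma (1 - θ))⁻¹ : ℂ)‖ₑ * (eLpNorm (𝓕⁻ f₁) (ENNReal.ofReal r) volume
        + eLpNorm (𝓕⁻ f₂) (ENNReal.ofReal r) volume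
        + eLpNorm (𝓕⁻ f₃) (ENNReal.ofReal r) volume) := by
        gcongr
        refine (eLpNorm_sub_le (c1.add c2) c3 hr').trans ?_
        gcongr
        exact eLpNorm_add_le c1 c2 hr'
    _ ≤ ENNReal.ofReal (Real.Gamma (1 - θ))⁻¹ *
        (ENNReal.ofReal (μ ^ (θ - 1) / (1 - θ)) * ENNReal.ofReal (B * μ ^ (k + 1))
          + ENNReal.ofReal (μ ^ θ) * ENNReal.ofReal (B * μ ^ k)
          + ENNReal.ofReal (μ ^ θ) * ENNReal.ofReal (B * μ ^ k)) := by
        gcongr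
        · rw [← Complex.ofReal_inv, ← ofReal_norm, Complex.norm_real,
            Real.norm_of_nonneg (by positivity)]
        · exact hb1.trans (by gcongr; exact hr1.trans hm1)
        · exact hb2.trans (by gcongr; exact hr2.trans hm2)
        · exact hb3.trans (by gcongr; exact hr3.trans hm3)
    _ = _ := by
        rw [← ENNReal.ofReal_mul (by positivity), ← ENNReal.ofReal_mul (by positivity),
          ← ENNReal.ofReal_add (by positivity) (by positivity),
          ← ENNReal.ofReal_add (by positivity) (by positivity),
          ← ENNReal.ofReal_mul (by positivity)]
        congr 1
        have m1 : μ ^ (θ - 1) * μ ^ (k + 1) = μ ^ (s / 2) := by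
          rw [← Real.rpow_natCast _ (k + 1), ← Real.rpow_add hμ]; congr 1; push_cast; rw [hθ]; ring
        have m2 : μ ^ θ * μ ^ k = μ ^ (s / 2) := by
          rw [← Real.rpow_natCast _ k, ← Real.rpow_add hμ]; congr 1; rw [hθ]; ring
        linear_combination (Real.Gamma (1 - θ))⁻¹ * B * (1 - θ)⁻¹ * m1
          + 2 * (Real.Gamma (1 - θ))⁻¹ * B * m2

end BesselPotential

section OscillatingFamilies

variable {E : Type*} [NormedAddCommGroup E] [InnerProductSpace ℝ E]

/-- Families `Σ_{j ≤ n} τ ^ j φ_j e^{iτp}` with amplitudes `φ_j` smooth of compact support. -/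
inductive IsOscillating (p : E → ℝ) : ℕ → (ℝ → E → ℂ) → Prop
  | amplitude (φ : E → ℂ) (hφ : ContDiff ℝ (⊤ : ℕ∞) φ) (hφc : HasCompactSupport φ) :
      IsOscillating p 0 fun τ x => φ x * Complex.exp (Complex.I * ((τ * p x : ℝ) : ℂ))
  | mul_param {n : ℕ} {G : ℝ → E → ℂ} (h : IsOscillating p n G) :
      IsOscillating p (n + 1) fun τ x => (τ : ℂ) * G τ x
  | succ {n : ℕ} {G : ℝ → E → ℂ} (h : IsOscillating p n G) : IsOscillating p (n + 1) G
  | neg {n : ℕ} {G : ℝ → E → ℂ} (h : IsOscillating p n G) :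
      IsOscillating p n fun τ x => -G τ x
  | add {n : ℕ} {G H : ℝ → E → ℂ} (hG : IsOscillating p n G) (hH : IsOscillating p n H) :
      IsOscillating p n fun τ x => G τ x + H τ x

namespace IsOscillating

variable {p : E → ℝ} {n : ℕ} {G : ℝ → E → ℂ}

lemma contDiff (hp : ContDiff ℝ (⊤ : ℕ∞) p) (h : IsOscillating p n G) (τ : ℝ) :
    ContDiff ℝ (⊤ : ℕ∞) (G τ) := by
  induction h with
  | amplitude φ hφ hφc =>
    have h1 : ContDiff ℝ (⊤ : ℕ∞) fun x => ((τ * p x : ℝ) : ℂ) :=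
      Complex.ofRealCLM.contDiff.comp (contDiff_const.mul hp)
    exact hφ.mul (contDiff_const.mul h1).cexp
  | mul_param _ ih => exact contDiff_const.mul ih
  | succ _ ih => exact ih
  | neg _ ih => exact ih.neg
  | add _ _ ih₁ ih₂ => exact ih₁.add ih₂

lemma fderiv_apply (hp : ContDiff ℝ (⊤ : ℕ∞) p) (h : IsOscillating p n G) (v : E) :
    IsOscillating p (n + 1) fun τ x => fderiv ℝ (G τ) x v := by
  have hdiff : ∀ {n : ℕ} {G : ℝ → E → ℂ}, IsOscillating p n G → ∀ τ, Differentiable ℝ (G τ) :=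
    fun h τ => (h.contDiff hp τ).differentiable (by simp)
  induction h with
  | amplitude φ hφ hφc =>
    have hpd : Differentiable ℝ p := hp.differentiable (by simp)
    have hφd : Differentiable ℝ φ := hφ.differentiable (by simp)
    have s1 : ContDiff ℝ (⊤ : ℕ∞) fun x => fderiv ℝ φ x v :=
      (hφ.fderiv_right (by simp)).clm_apply contDiff_const
    have s2 : ContDiff ℝ (⊤ : ℕ∞) fun x => Complex.I * ((fderiv ℝ p x v : ℝ) : ℂ) * φ x :=
      (contDiff_const.mul (Complex.ofRealCLM.contDiff.comp
        ((hp.fderiv_right (by simp)).clm_apply contDiff_const))).mul hφ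
    have k1 : HasCompactSupport fun x => fderiv ℝ φ x v := by
      exact hφc.fderiv_apply ℝ v
    have k2 : HasCompactSupport fun x => Complex.I * ((fderiv ℝ p x v : ℝ) : ℂ) * φ x :=
      hφc.mul_left
    convert ((amplitude (p := p) _ s1 k1).succ).add (amplitude (p := p) _ s2 k2).mul_param using 3
      with τ x
    have e1 : HasFDerivAt (fun x => ((τ * p x : ℝ) : ℂ))
        (Complex.ofRealCLM.comp (τ • fderiv ℝ p x)) x :=
      Complex.ofRealCLM.hasFDerivAt.comp x ((hpd x).hasFDerivAt.const_mul τ)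
    have e2 : HasFDerivAt (fun x => φ x * Complex.exp (Complex.I * ((τ * p x : ℝ) : ℂ))) _ x :=
      (hφd x).hasFDerivAt.mul (e1.const_mul Complex.I).cexp
    beta_reduce
    rw [e2.fderiv]
    simp
    ring
  | mul_param h ih =>
    convert ih.mul_param using 3 with τ x
    rw [fderiv_const_mul (hdiff h τ x)]
    simp
  | succ _ ih => exact ih.succ
  | neg _ ih =>
    convert ih.neg using 3 with τ x
    rw [fderiv_fun_neg]; rfl
  | add h₁ h₂ ih₁ ih₂ =>
    convert ih₁.add ih₂ using 3 with τ x
    rw [fderiv_fun_add (hdiff h₁ τ x) (hdiff h₂ τ x)]; rfl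

lemma zero (p : E → ℝ) (n : ℕ) : IsOscillating p n fun _ _ => 0 := by
  induction n with
  | zero => simpa using! amplitude (p := p) 0 contDiff_const HasCompactSupport.zero
  | succ n ih => exact ih.succ

lemma sum {ι : Type*} (s : Finset ι) {G : ι → ℝ → E → ℂ} (h : ∀ i, IsOscillating p n (G i)) :
    IsOscillating p n fun τ x => ∑ i ∈ s, G i τ x := by
  classical
  induction s using Finset.induction_on with
  | empty => simpa using zero p n
  | insert i s hi ih => simpa only [Finset.sum_insert hi] using (h i).add ih

lemma exists_norm_le (h : IsOscillating p n G) :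
    ∃ C : ℝ, 0 ≤ C ∧ ∃ K : Set E, IsCompact K ∧ ∀ τ : ℝ, 1 ≤ τ → ∀ x,
      ‖G τ x‖ ≤ C * τ ^ n ∧ (x ∉ K → G τ x = 0) := by
  induction h with
  | amplitude φ hφ hφc =>
    obtain ⟨C, hC⟩ := hφ.continuous.bounded_above_of_compact_support hφc
    refine ⟨C, (norm_nonneg _).trans (hC 0), tsupport φ, hφc, fun τ _ x => ⟨?_, fun hx => ?_⟩⟩
    · rw [norm_mul, mul_comm Complex.I, Complex.norm_exp_ofReal_mul_I]
      simpa using hC x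
    · simp [image_eq_zero_of_notMem_tsupport hx]
  | mul_param _ ih =>
    obtain ⟨C, hC, K, hK, hb⟩ := ih
    refine ⟨C, hC, K, hK, fun τ hτ x => ⟨?_, fun hx => by simp [(hb τ hτ x).2 hx]⟩⟩
    rw [norm_mul, Complex.norm_real, Real.norm_of_nonneg (by linarith), pow_succ']
    calc _ ≤ τ * (C * τ ^ _) := by gcongr; exact (hb τ hτ x).1
      _ = _ := by ring
  | succ _ ih =>
    obtain ⟨C, hC, K, hK, hb⟩ := ih
    refine ⟨C, hC, K, hK, fun τ hτ x => ⟨(hb τ hτ x).1.trans ?_, (hb τ hτ x).2⟩⟩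
    gcongr
    simp
  | neg _ ih =>
    obtain ⟨C, hC, K, hK, hb⟩ := ih
    exact ⟨C, hC, K, hK, fun τ hτ x => ⟨by rw [norm_neg]; exact (hb τ hτ x).1,
      fun hx => by simp [(hb τ hτ x).2 hx]⟩⟩
  | add _ _ ih₁ ih₂ =>
    obtain ⟨C, hC, K, hK, hb⟩ := ih₁
    obtain ⟨C', hC', K', hK', hb'⟩ := ih₂
    refine ⟨C + C', add_nonneg hC hC', K ∪ K', hK.union hK', fun τ hτ x => ⟨?_, fun hx => ?_⟩⟩
    · rw [add_mul]
      exact (norm_add_le _ _).trans (add_le_add (hb τ hτ x).1 (hb' τ hτ x).1)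
    · simp [(hb τ hτ x).2 fun h => hx (.inl h), (hb' τ hτ x).2 fun h => hx (.inr h)]

variable [FiniteDimensional ℝ E]

lemma sub_laplacian (hp : ContDiff ℝ (⊤ : ℕ∞) p) {g : ℝ → 𝓢(E, ℂ)}
    (h : IsOscillating p n fun τ => g τ) :
    IsOscillating p (n + 2) fun τ => ⇑(g τ - Δ (g τ)) := by
  have h1 := h.succ.succ.add (IsOscillating.sum Finset.univ fun i =>
    (h.fderiv_apply hp (stdOrthonormalBasis ℝ E i)).fderiv_apply hp (stdOrthonormalBasis ℝ E i)).neg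
  convert h1 using 3 with τ x
  rw [sub_apply, SchwartzMap.laplacian_eq_sum (stdOrthonormalBasis ℝ E), sum_apply, sub_eq_add_neg]
  rfl

lemma iterate_sub_laplacian (hp : ContDiff ℝ (⊤ : ℕ∞) p) {g : ℝ → 𝓢(E, ℂ)}
    (h : IsOscillating p 0 fun τ => g τ) (k : ℕ) :
    IsOscillating p (2 * k) fun τ => ⇑((fun f : 𝓢(E, ℂ) => f - Δ f)^[k] (g τ)) := by
  induction k with
  | zero => exact h
  | succ k ih =>
    simp only [Function.iterate_succ_apply']
    exact ih.sub_laplacian hp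

variable [MeasurableSpace E] [BorelSpace E]

lemma exists_enorm_le (h : IsOscillating p n G) :
    ∃ C : ℝ, 0 ≤ C ∧ ∀ τ : ℝ, 1 ≤ τ → (∀ x, ‖G τ x‖ₑ ≤ ENNReal.ofReal (C * τ ^ n)) ∧
      ∫⁻ x, ‖G τ x‖ₑ ≤ ENNReal.ofReal (C * τ ^ n) := by
  obtain ⟨C, hC, K, hK, hb⟩ := h.exists_norm_le
  have hsup : ∀ τ : ℝ, 1 ≤ τ → ∀ x, ‖G τ x‖ₑ ≤ ENNReal.ofReal (C * τ ^ n) := fun τ hτ x => by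
    rw [← ofReal_norm]
    exact ENNReal.ofReal_le_ofReal (hb τ hτ x).1
  refine ⟨C + C * volume.real K, by positivity, fun τ hτ => ⟨fun x => (hsup τ hτ x).trans ?_, ?_⟩⟩
  · gcongr
    exact le_add_of_nonneg_right (by positivity)
  · calc ∫⁻ x, ‖G τ x‖ₑ = ∫⁻ x in K, ‖G τ x‖ₑ := by
          refine (setLIntegral_eq_of_support_subset ?_).symm
          intro x hx
          by_contra hxK
          exact hx (by simp [(hb τ hτ x).2 hxK])
      _ ≤ ∫⁻ x in K, ENNReal.ofReal (C * τ ^ n) := lintegral_mono fun x => hsup τ hτ x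
      _ = ENNReal.ofReal (C * τ ^ n) * volume K := by rw [setLIntegral_const]
      _ = ENNReal.ofReal (C * volume.real K * τ ^ n) := by
          rw [← ofReal_measureReal hK.measure_lt_top.ne, ← ENNReal.ofReal_mul (by positivity)]
          congr 1; ring
      _ ≤ _ := by
          gcongr
          exact le_add_of_nonneg_left hC

end IsOscillating

end OscillatingFamilies

section OscillatingMultipliers

variable {ι : Type*} [Fintype ι]

lemma exists_sobolevNorm_oscillating_le {s r : ℝ} (hs : 0 ≤ s) (hr : 1 ≤ r)
    {p : EuclideanSpace ℝ ι → ℝ} (hp : ContDiff ℝ (⊤ : ℕ∞) p)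
    {φ : EuclideanSpace ℝ ι → ℂ} (hφ : ContDiff ℝ (⊤ : ℕ∞) φ) (hφc : HasCompactSupport φ) :
    ∃ C : ℝ, ∀ τ : ℝ, 1 ≤ τ →
      sobolevNorm s r (fun x => φ x * Complex.exp (Complex.I * ((τ * p x : ℝ) : ℂ)))
        ≤ ENNReal.ofReal (C * τ ^ s) := by
  have hosc := IsOscillating.amplitude (p := p) φ hφ hφc
  let g : ℝ → 𝓢(EuclideanSpace ℝ ι, ℂ) := fun τ =>
    HasCompactSupport.toSchwartzMap (hφc.mul_right) (hosc.contDiff hp τ)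
  have hg : IsOscillating p 0 fun τ => ⇑(g τ) := hosc
  choose D hD0 hD using fun i => (hg.iterate_sub_laplacian hp i).exists_enorm_le
  obtain ⟨C, hC⟩ := exists_eLpNorm_bessel_le (E := EuclideanSpace ℝ ι) hs hr
  set N := ⌊s / 2⌋₊ + 1
  set B := ∑ i ∈ Finset.range (N + 1), D i with hB
  refine ⟨C * B, fun τ hτ => ?_⟩
  have hτ0 : 0 < τ := by linarith
  have hle : ∀ i ≤ N, ENNReal.ofReal (D i * τ ^ (2 * i)) ≤ ENNReal.ofReal (B * (τ ^ 2) ^ i) := by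
    intro i hi
    rw [← pow_mul]
    gcongr
    exact Finset.single_le_sum (fun j _ => hD0 j) (Finset.mem_range.2 (by omega))
  have key := hC (g τ) B (τ ^ 2) (Finset.sum_nonneg fun i _ => hD0 i) (by positivity)
    fun i hi => ⟨fun x => ((hD i τ hτ).1 x).trans (hle i hi), (hD i τ hτ).2.trans (hle i hi)⟩
  refine key.trans_eq ?_
  rw [← Real.rpow_natCast τ 2, ← Real.rpow_mul hτ0.le, mul_assoc]
  congr 4
  push_cast
  ring

lemma sobolevNorm_lt_top {s r : ℝ} (hs : 0 ≤ s) (hr : 1 ≤ r)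
    {φ : EuclideanSpace ℝ ι → ℂ} (hφ : ContDiff ℝ (⊤ : ℕ∞) φ) (hφc : HasCompactSupport φ) :
    sobolevNorm s r φ < ⊤ := by
  obtain ⟨C, hC⟩ := exists_sobolevNorm_oscillating_le hs hr (p := fun _ => 0) contDiff_const hφ hφc
  exact (by simpa using hC 1 le_rfl : sobolevNorm s r φ ≤ ENNReal.ofReal C).trans_lt
    ENNReal.ofReal_lt_top

lemma sobolevNorm_const_mul (s r : ℝ) (c : ℂ) (g : EuclideanSpace ℝ ι → ℂ) :
    sobolevNorm s r (fun x => c * g x) = ‖c‖ₑ * sobolevNorm s r g := by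
  have h1 : ∀ f : EuclideanSpace ℝ ι → ℂ, 𝓕 (fun x => c * f x) = fun ξ => c * 𝓕 f ξ :=
    fun f => VectorFourier.fourierIntegral_const_smul _ _ _ f c
  have h2 : ∀ f : EuclideanSpace ℝ ι → ℂ, 𝓕⁻ (fun x => c * f x) = c • 𝓕⁻ f :=
    fun f => VectorFourier.fourierIntegral_const_smul _ _ _ f c
  rw [sobolevNorm, sobolevNorm, h1]
  simp_rw [mul_left_comm _ c]
  rw [h2, eLpNorm_const_smul]

lemma sobolevNorm_zero (s r : ℝ) :
    sobolevNorm s r (fun _ : EuclideanSpace ℝ ι => 0) = 0 := by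
  simpa using sobolevNorm_const_mul s r 0 (fun _ : EuclideanSpace ℝ ι => 0)

lemma exists_contDiff_eq_norm_rpow {E : Type*} [NormedAddCommGroup E] [InnerProductSpace ℝ E]
    (c : ℝ) {δ : ℝ} (hδ : 0 < δ) :
    ∃ p : E → ℝ, ContDiff ℝ (⊤ : ℕ∞) p ∧ ∀ x, δ ≤ ‖x‖ → p x = ‖x‖ ^ c := by
  let χ : ContDiffBump (0 : E) := ⟨δ / 2, δ, by linarith, by linarith⟩
  refine ⟨fun x => (‖x‖ ^ 2 + χ x) ^ (c / 2),
    ((contDiff_norm_sq ℝ).add χ.contDiff).rpow_const_of_ne fun x => ?_, fun x hx => ?_⟩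
  · rcases eq_or_ne x 0 with rfl | hx
    · rw [χ.one_of_mem_closedBall (Metric.mem_closedBall_self χ.rIn_pos.le)]
      simp
    · exact (add_pos_of_pos_of_nonneg (by positivity) χ.nonneg).ne'
  · beta_reduce
    rw [χ.zero_of_le_dist (by simpa using hx), add_zero, ← Real.rpow_natCast,
      ← Real.rpow_mul (norm_nonneg x)]
    congr 1
    push_cast
    ring

end OscillatingMultipliers

end FractionalBounds

/-- The oscillating multiplier `m_{a,b}(ξ) = ψ(ξ)|ξ|^{-b} e^{i|ξ|^a}` satisfies the
Hörmander condition with `s = b/a` derivatives in `L^r`, `rs > d`, uniformly over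
dyadic dilations. -/
theorem oscillating_multiplier_hormander (d : ℕ) (hd : 0 < d)
    (a b : ℝ) (ha : 0 < a) (ha1 : a ≠ 1) (hb : 0 < b)
    (ψ : EuclideanSpace ℝ (Fin d) → ℂ) (hψ : ContDiff ℝ (⊤ : ℕ∞) ψ)
    (ε : ℝ) (hε : 0 < ε) (hψ0 : ∀ ξ : EuclideanSpace ℝ (Fin d), ‖ξ‖ < ε → ψ ξ = 0)
    (R : ℝ) (hψ1 : ∀ ξ : EuclideanSpace ℝ (Fin d), R < ‖ξ‖ → ψ ξ = 1)
    (m : EuclideanSpace ℝ (Fin d) → ℂ)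
    (hm : ∀ ξ, m ξ = ψ ξ * ((‖ξ‖ ^ (-b) : ℝ) : ℂ) * Complex.exp (Complex.I * ((‖ξ‖ ^ a : ℝ) : ℂ)))
    (Ψ : SchwartzMap (EuclideanSpace ℝ (Fin d)) ℂ)
    (hΨsupp : ∀ ξ, 𝓕 ⇑Ψ ξ ≠ 0 → (1 : ℝ) / 2 ≤ ‖ξ‖ ∧ ‖ξ‖ ≤ 2)
    (hΨsum : ∀ ξ : EuclideanSpace ℝ (Fin d), ξ ≠ 0 →
      ∑' j : ℤ, 𝓕 ⇑Ψ ((2 : ℝ) ^ (-j) • ξ) = 1)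
    (r : ℝ) (hr : 1 < r) (hrs : (d : ℝ) < r * (b / a)) :
    (⨆ j : ℤ, sobolevNorm (b / a) r (fun ξ => m ((2 : ℝ) ^ j • ξ) * 𝓕 ⇑Ψ ξ)) < ⊤ := by
  have hs : 0 ≤ b / a := by positivity
  obtain ⟨p, hp, hpeq⟩ := exists_contDiff_eq_norm_rpow (E := EuclideanSpace ℝ (Fin d)) a
    (δ := 1 / 2) (by norm_num)
  obtain ⟨q, hq, hqeq⟩ := exists_contDiff_eq_norm_rpow (E := EuclideanSpace ℝ (Fin d)) (-b)
    (δ := 1 / 2) (by norm_num)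
  have hΨc : HasCompactSupport (𝓕 ⇑Ψ) :=
    HasCompactSupport.of_support_subset_isCompact (isCompact_closedBall 0 2)
      fun ξ hξ => by simpa using (hΨsupp ξ hξ).2
  have hΨs : ContDiff ℝ (⊤ : ℕ∞) (𝓕 ⇑Ψ) := by
    rw [← SchwartzMap.fourier_coe]
    exact (𝓕 Ψ).smooth ⊤
  set φ : EuclideanSpace ℝ (Fin d) → ℂ := fun ξ => (q ξ : ℂ) * 𝓕 ⇑Ψ ξ with hφdef
  have hφ : ContDiff ℝ (⊤ : ℕ∞) φ := (Complex.ofRealCLM.contDiff.comp hq).mul hΨs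
  have hφc : HasCompactSupport φ := hΨc.mul_left
  have heq : ∀ (j : ℤ) ξ, m ((2 : ℝ) ^ j • ξ) * 𝓕 ⇑Ψ ξ =
      ((((2 : ℝ) ^ j) ^ (-b) : ℝ) : ℂ) * (ψ ((2 : ℝ) ^ j • ξ) *
        (φ ξ * Complex.exp (Complex.I * ((((2 : ℝ) ^ j) ^ a * p ξ : ℝ) : ℂ)))) := by
    intro j ξ
    by_cases h0 : 𝓕 ⇑Ψ ξ = 0
    · simp [hφdef, h0]
    have h2 : (0 : ℝ) ≤ (2 : ℝ) ^ j := by positivity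
    rw [hm, hpeq ξ (hΨsupp ξ h0).1, norm_smul, Real.norm_of_nonneg h2,
      Real.mul_rpow h2 (norm_nonneg ξ), Real.mul_rpow h2 (norm_nonneg ξ), hφdef]
    beta_reduce
    rw [hqeq ξ (hΨsupp ξ h0).1]
    push_cast
    ring
  have hfin : ∀ j : ℤ, sobolevNorm (b / a) r (fun ξ => m ((2 : ℝ) ^ j • ξ) * 𝓕 ⇑Ψ ξ) < ⊤ := by
    intro j
    refine sobolevNorm_lt_top hs hr.le ?_ hΨc.mul_left
    simp_rw [heq]
    exact contDiff_const.mul ((hψ.comp (contDiff_const_smul _)).mul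
      ((IsOscillating.amplitude (p := p) φ hφ hφc).contDiff hp _))
  obtain ⟨C, hC⟩ := exists_sobolevNorm_oscillating_le hs hr.le hp hφ hφc
  obtain ⟨J₁, hJ₁⟩ : ∃ J : ℕ, 2 * R < 2 ^ J := pow_unbounded_of_one_lt _ one_lt_two
  obtain ⟨J₀, hJ₀⟩ : ∃ J : ℕ, 2 / ε < 2 ^ J := pow_unbounded_of_one_lt _ one_lt_two
  have hlow : ∀ j : ℤ, j < -J₀ →
      sobolevNorm (b / a) r (fun ξ => m ((2 : ℝ) ^ j • ξ) * 𝓕 ⇑Ψ ξ) = 0 := by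
    intro j hj
    rw [← sobolevNorm_zero (ι := Fin d) (b / a) r]
    congr 1
    ext ξ
    by_cases h0 : 𝓕 ⇑Ψ ξ = 0
    · rw [h0, mul_zero]
    have h1 : (2 : ℝ) ^ j ≤ (2 ^ J₀)⁻¹ := by
      rw [← zpow_natCast, ← zpow_neg]
      exact zpow_le_zpow_right₀ one_le_two hj.le
    have h2 : ‖(2 : ℝ) ^ j • ξ‖ < ε := by
      rw [norm_smul, Real.norm_of_nonneg (by positivity)]
      calc (2 : ℝ) ^ j * ‖ξ‖ ≤ (2 ^ J₀)⁻¹ * 2 := by gcongr; exact (hΨsupp ξ h0).2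
        _ < ε := by
          rw [div_lt_iff₀ hε] at hJ₀
          rwa [inv_mul_lt_iff₀ (by positivity)]
    rw [hm, hψ0 _ h2]
    simp
  have hhigh : ∀ j : ℤ, J₁ ≤ j →
      sobolevNorm (b / a) r (fun ξ => m ((2 : ℝ) ^ j • ξ) * 𝓕 ⇑Ψ ξ) ≤ ENNReal.ofReal C := by
    intro j hj
    have h1 : (2 : ℝ) ^ J₁ ≤ 2 ^ j := by
      rw [← zpow_natCast]
      exact zpow_le_zpow_right₀ one_le_two hj
    have h2 : (1 : ℝ) ≤ 2 ^ j := one_le_zpow₀ one_le_two (by omega)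
    have h3 : (fun ξ => m ((2 : ℝ) ^ j • ξ) * 𝓕 ⇑Ψ ξ) = fun ξ =>
        ((((2 : ℝ) ^ j) ^ (-b) : ℝ) : ℂ) *
          (φ ξ * Complex.exp (Complex.I * ((((2 : ℝ) ^ j) ^ a * p ξ : ℝ) : ℂ))) := by
      ext ξ
      rw [heq]
      by_cases h0 : 𝓕 ⇑Ψ ξ = 0
      · simp [hφdef, h0]
      rw [hψ1, one_mul]
      rw [norm_smul, Real.norm_of_nonneg (by positivity)]
      nlinarith [(hΨsupp ξ h0).1]
    rw [h3, sobolevNorm_const_mul]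
    refine (mul_le_mul_right (hC _ (Real.one_le_rpow h2 ha.le)) _).trans_eq ?_
    rw [← ofReal_norm, Complex.norm_real, Real.norm_of_nonneg (by positivity),
      ← ENNReal.ofReal_mul (by positivity), ← Real.rpow_mul (by positivity),
      mul_div_cancel₀ _ ha.ne', mul_left_comm, ← Real.rpow_add (by positivity), neg_add_cancel,
      Real.rpow_zero, mul_one]
  have hsum : ∑ j ∈ Finset.Icc (-(J₀ : ℤ)) J₁,
      sobolevNorm (b / a) r (fun ξ => m ((2 : ℝ) ^ j • ξ) * 𝓕 ⇑Ψ ξ) < ⊤ :=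
    ENNReal.sum_lt_top.2 fun j _ => hfin j
  refine lt_of_le_of_lt (iSup_le fun j => ?_)
    (ENNReal.add_lt_top.2 ⟨hsum, ENNReal.ofReal_lt_top (r := C)⟩)
  rcases lt_or_ge j (-(J₀ : ℤ)) with h | h
  · simp [hlow j h]
  rcases le_or_gt (J₁ : ℤ) j with h' | h'
  · exact (hhigh j h').trans le_add_self
  · exact (Finset.single_le_sum (f := fun j : ℤ => sobolevNorm (b / a) r
      (fun ξ => m ((2 : ℝ) ^ j • ξ) * 𝓕 ⇑Ψ ξ)) (fun _ _ => zero_le)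
      (Finset.mem_Icc.2 ⟨h, h'.le⟩)).trans le_self_add
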